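/- For n ≥ 2 and every X ∈ Y_{d,n−1}^B, tr_n(g_{n−1} X g_{n−1}^{−1}) = tr_{n−1}(X) = tr_n(g_{n−1}^{−1} X g_{n−1}). -/

import Mathlib

set_option maxHeartbeats 1000000
set_option synthInstance.maxHeartbeats 400000

noncomputable section

/-- The field `L = ℂ(u,v,z)` of rational functions in three indeterminates over `ℂ`. -/
abbrev Kf : Type := FractionRing (MvPolynomial (Fin 3) ℂ)

/-- The indeterminate `u`. -/
def uu : Kf := algebraMap (MvPolynomial (Fin 3) ℂ) Kf (MvPolynomial.X 0)

/-- The indeterminate `v`. -/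
def vv : Kf := algebraMap (MvPolynomial (Fin 3) ℂ) Kf (MvPolynomial.X 1)

/-- The indeterminate `z`. -/
def zz : Kf := algebraMap (MvPolynomial (Fin 3) ℂ) Kf (MvPolynomial.X 2)

/-- Generators of the framization of the Hecke algebra of type B on `n` strands:
`b` is the generator `b₁`, `g i` is the braiding generator `g_{i+1}` (`i : Fin (n-1)`),
and `t j` is the framing generator `t_{j+1}` (`j : Fin n`). -/
inductive Gen (n : ℕ) : Type
  | b : Gen n
  | g : Fin (n - 1) → Gen n
  | t : Fin n → Gen n

/-- The free algebra on the generators. -/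
abbrev FA (n : ℕ) : Type := FreeAlgebra Kf (Gen n)

/-- The generator `b₁` in the free algebra. -/
def Bb (n : ℕ) : FA n := FreeAlgebra.ι Kf Gen.b

/-- The generator `g_i` (for `1 ≤ i ≤ n-1`) in the free algebra; junk value `1` out of range. -/
def Gg (n i : ℕ) : FA n :=
  if h : 1 ≤ i ∧ i ≤ n - 1 then FreeAlgebra.ι Kf (Gen.g ⟨i - 1, by omega⟩) else 1

/-- The generator `t_j` (for `1 ≤ j ≤ n`) in the free algebra; junk value `1` out of range. -/
def Tt (n j : ℕ) : FA n :=
  if h : 1 ≤ j ∧ j ≤ n then FreeAlgebra.ι Kf (Gen.t ⟨j - 1, by omega⟩) else 1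

/-- The element `e_i = (1/d) ∑_{m=0}^{d-1} t_i^m t_{i+1}^{d-m}` in the free algebra. -/
def eF (d n i : ℕ) : FA n :=
  (d : Kf)⁻¹ • ∑ m ∈ Finset.range d, Tt n i ^ m * Tt n (i + 1) ^ (d - m)

/-- The element `f₁ = (1/d) ∑_{m=0}^{d-1} t₁^m` in the free algebra. -/
def fF (d n : ℕ) : FA n :=
  (d : Kf)⁻¹ • ∑ m ∈ Finset.range d, Tt n 1 ^ m

/-- The action of the simple transposition `s_i` on indices: swaps `i` and `i+1`. -/
def sAct (i j : ℕ) : ℕ := if j = i then i + 1 else if j = i + 1 then i else j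

/-- The defining relations of the framization `Y_{d,n}^B` of the Hecke algebra of type B. -/
inductive YBrel (d n : ℕ) : FA n → FA n → Prop
  | gg : ∀ i j : ℕ, 1 ≤ i → i ≤ n - 1 → 1 ≤ j → j ≤ n - 1 → (i + 1 < j ∨ j + 1 < i) →
      YBrel d n (Gg n i * Gg n j) (Gg n j * Gg n i)
  | braid : ∀ i : ℕ, 1 ≤ i → i ≤ n - 2 →
      YBrel d n (Gg n i * Gg n (i + 1) * Gg n i) (Gg n (i + 1) * Gg n i * Gg n (i + 1))
  | bg : ∀ i : ℕ, 2 ≤ i → i ≤ n - 1 → YBrel d n (Bb n * Gg n i) (Gg n i * Bb n)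
  | bgbg : YBrel d n (Bb n * Gg n 1 * Bb n * Gg n 1) (Gg n 1 * Bb n * Gg n 1 * Bb n)
  | tt : ∀ i j : ℕ, 1 ≤ i → i ≤ n → 1 ≤ j → j ≤ n →
      YBrel d n (Tt n i * Tt n j) (Tt n j * Tt n i)
  | tg : ∀ i j : ℕ, 1 ≤ i → i ≤ n - 1 → 1 ≤ j → j ≤ n →
      YBrel d n (Tt n j * Gg n i) (Gg n i * Tt n (sAct i j))
  | tb : ∀ i : ℕ, 1 ≤ i → i ≤ n → YBrel d n (Tt n i * Bb n) (Bb n * Tt n i)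
  | td : ∀ i : ℕ, 1 ≤ i → i ≤ n → YBrel d n (Tt n i ^ d) 1
  | gsq : ∀ i : ℕ, 1 ≤ i → i ≤ n - 1 →
      YBrel d n (Gg n i ^ 2) (1 + (uu - uu⁻¹) • (eF d n i * Gg n i))
  | bsq : YBrel d n (Bb n ^ 2) (1 + (vv - vv⁻¹) • (fF d n * Bb n))

/-- The framization of the Hecke algebra of type B, `Y_{d,n}^B`. -/
abbrev YB (d n : ℕ) : Type := RingQuot (YBrel d n)

instance (d n : ℕ) : Ring (YB d n) := RingQuot.instRing (YBrel d n)

instance (d n : ℕ) : Algebra Kf (YB d n) := RingQuot.instAlgebra _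

instance (d n : ℕ) : Module Kf (YB d n) := Algebra.toModule

/-- The canonical projection from the free algebra onto `Y_{d,n}^B`. -/
def mkY (d n : ℕ) : FA n →ₐ[Kf] YB d n := RingQuot.mkAlgHom Kf (YBrel d n)

/-- The generator `b₁` of `Y_{d,n}^B`. -/
def bY (d n : ℕ) : YB d n := mkY d n (Bb n)

/-- The generator `g_i` of `Y_{d,n}^B`. -/
def gY (d n : ℕ) (i : ℕ) : YB d n := mkY d n (Gg n i)

/-- The generator `t_j` of `Y_{d,n}^B`. -/
def tY (d n : ℕ) (j : ℕ) : YB d n := mkY d n (Tt n j)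

/-- The idempotent `e_i` of `Y_{d,n}^B`. -/
def eY (d n : ℕ) (i : ℕ) : YB d n := mkY d n (eF d n i)

/-- The idempotent `f₁` of `Y_{d,n}^B`. -/
def fY (d n : ℕ) : YB d n := mkY d n (fF d n)

/-- The element `g_i⁻¹ = g_i - (u - u⁻¹) e_i`. -/
def gInv (d n i : ℕ) : YB d n := gY d n i - (uu - uu⁻¹) • eY d n i

/-- The elements `b_k := g_{k-1} ⋯ g_1 b_1 g_1⁻¹ ⋯ g_{k-1}⁻¹` for `2 ≤ k ≤ n`,
defined by `b_k = g_{k-1} b_{k-1} g_{k-1}⁻¹`; with `b_1` the generator `b₁`. -/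
def bk (d n : ℕ) : ℕ → YB d n
  | 0 => 1
  | 1 => bY d n
  | (k + 2) => gY d n (k + 1) * bk d n (k + 1) * gInv d n (k + 1)

/-- The descending product `g_{k-1} g_{k-2} ⋯ g_j`. -/
def gRange (d n j k : ℕ) : YB d n := (((List.range' j (k - j)).reverse).map (gY d n)).prod

/-- The elements `𝔪⁺_{k,j,m}`: `𝔪⁺_{k,k,m} = t_k^m` and
`𝔪⁺_{k,j,m} = g_{k-1} ⋯ g_j t_j^m` for `j < k`. -/
def mPlus (d n k j m : ℕ) : YB d n :=
  if j = k then tY d n k ^ m else gRange d n j k * tY d n j ^ m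

/-- The elements `𝔪⁻_{k,j,m}`: `𝔪⁻_{k,k,m} = t_k^m b_k` and
`𝔪⁻_{k,j,m} = g_{k-1} ⋯ g_j b_j t_j^m` for `j < k`. -/
def mMinus (d n k j m : ℕ) : YB d n :=
  if j = k then tY d n k ^ m * bk d n k else gRange d n j k * (bk d n j * tY d n j ^ m)

/-- The subsets `M_{d,k}` of `Y_{d,n}^B`:
`M_{d,1} = {t₁^m, t₁^m b₁}` and `M_{d,k} = {t_k^m, t_k^m b_k, g_{k-1} x : x ∈ M_{d,k-1}}`. -/
def Mset (d n : ℕ) : ℕ → Set (YB d n)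
  | 0 => {1}
  | 1 => {x | ∃ m ≤ d - 1, x = tY d n 1 ^ m ∨ x = tY d n 1 ^ m * bY d n}
  | (k + 2) => {x |
      (∃ m ≤ d - 1, x = tY d n (k + 2) ^ m ∨ x = tY d n (k + 2) ^ m * bk d n (k + 2)) ∨
      ∃ y ∈ Mset d n (k + 1), x = gY d n (k + 1) * y}

/-- The set `𝖢_n` of all products `𝔪_1 𝔪_2 ⋯ 𝔪_n` with `𝔪_i ∈ M_{d,i}`. -/
def Cset (d n : ℕ) : Set (YB d n) :=
  {x | ∃ f : Fin n → YB d n, (∀ i : Fin n, f i ∈ Mset d n (i.val + 1)) ∧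
    x = (List.ofFn f).prod}

/-- Characterization of the natural inclusion `Y_{d,n}^B ⊆ Y_{d,n+1}^B`:
the algebra map sending generators to the generators of the same name. -/
def IsIncl (d n : ℕ) (inc : YB d n →ₐ[Kf] YB d (n + 1)) : Prop :=
  inc (bY d n) = bY d (n + 1) ∧
  (∀ i, 1 ≤ i → i ≤ n - 1 → inc (gY d n i) = gY d (n + 1) i) ∧
  (∀ j, 1 ≤ j → j ≤ n → inc (tY d n j) = tY d (n + 1) j)

/-- Characterization of the relative trace `tr_{n+1} : Y_{d,n+1}^B → Y_{d,n}^B`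
(with respect to trace parameters `x`, `y`): it is the `L`-linear map defined on the
basis `𝖢_{n+1}` by `tr(w t_{n+1}^m) = x_m w`, `tr(w b_{n+1} t_{n+1}^m) = y_m w`, and
`tr(w 𝔪^±_{n+1,k,m}) = z (w 𝔪^±_{n,k,m})` for `k < n+1`, where `w ∈ 𝖢_n`. -/
def IsRelTrace (d : ℕ) (x y : ZMod d → Kf) (n : ℕ)
    (inc : YB d n →ₐ[Kf] YB d (n + 1)) (tr : YB d (n + 1) →ₗ[Kf] YB d n) : Prop :=
  ∀ w ∈ Cset d n, ∀ m : ℕ, m ≤ d - 1 →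
    (tr (inc w * tY d (n + 1) (n + 1) ^ m) = x (m : ZMod d) • w) ∧
    (tr (inc w * (bk d (n + 1) (n + 1) * tY d (n + 1) (n + 1) ^ m)) = y (m : ZMod d) • w) ∧
    (∀ k, 1 ≤ k → k ≤ n →
      tr (inc w * mPlus d (n + 1) (n + 1) k m) = zz • (w * mPlus d n n k m) ∧
      tr (inc w * mMinus d (n + 1) (n + 1) k m) = zz • (w * mMinus d n n k m))

/-- Characterization of the trace `tr_1 : Y_{d,1}^B → L`:
`tr_1(t₁^a) = x_a` and `tr_1(b₁ t₁^a) = y_a`. -/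
def IsTr1 (d : ℕ) (x y : ZMod d → Kf) (tr1 : YB d 1 →ₗ[Kf] Kf) : Prop :=
  ∀ a : ℕ, a ≤ d - 1 →
    tr1 (tY d 1 1 ^ a) = x (a : ZMod d) ∧ tr1 (bY d 1 * tY d 1 1 ^ a) = y (a : ZMod d)

/-- The Markov trace tower `Tr_{m+1} = tr_1 ∘ tr_2 ∘ ⋯ ∘ tr_{m+1} : Y_{d,m+1}^B → L`,
built from the relative traces (`tr k` here is the relative trace
`tr_{k+2} : Y_{d,k+2}^B → Y_{d,k+1}^B`). -/
def TrT (d : ℕ) (tr1 : YB d 1 →ₗ[Kf] Kf)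
    (tr : (k : ℕ) → (YB d (k + 2) →ₗ[Kf] YB d (k + 1))) :
    (m : ℕ) → (YB d (m + 1) →ₗ[Kf] Kf)
  | 0 => tr1
  | (m + 1) => (TrT d tr1 tr m).comp (tr m)

/-! ### Two identities for invertible elements of a monoid -/

section Monoid

variable {M : Type*} [Monoid M] {a a' b b' : M}

lemma mul_mul_inv_of_braid (ha : a * a' = 1) (hb : b' * b = 1) (h : a * b * a = b * a * b) :
    a * b * a' = b' * a * b := by
  calc a * b * a' = b' * (b * a * b) * a' := by rw [← mul_assoc, ← mul_assoc, hb, one_mul]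
    _ = b' * a * b * (a * a') := by rw [← h]; simp only [mul_assoc]
    _ = b' * a * b := by rw [ha, mul_one]

lemma inv_mul_mul_of_braid (ha : a' * a = 1) (hb : b * b' = 1) (h : a * b * a = b * a * b) :
    a' * b * a = b * a * b' := by
  calc a' * b * a = a' * (b * a * b) * b' := by simp only [mul_assoc, hb, mul_one]
    _ = a' * a * b * a * b' := by rw [← h]; simp only [mul_assoc]
    _ = b * a * b' := by rw [ha, one_mul]

lemma commute_inv_right (h₁ : a * a' = 1) (h₂ : a' * a = 1) (h : Commute b a) : Commute b a' := by
  calc b * a' = a' * (a * b) * a' := by rw [← mul_assoc, h₂, one_mul]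
    _ = a' * b * (a * a') := by rw [← h.eq]; simp only [mul_assoc]
    _ = a' * b := by rw [h₁, mul_one]

end Monoid

/-! ### The defining relations inside the algebra -/

section Relations

variable {d n : ℕ}

lemma mkY_rel {a b : FA n} (h : YBrel d n a b) : mkY d n a = mkY d n b :=
  RingQuot.mkAlgHom_rel Kf h

lemma gY_commute {i j : ℕ} (hi : 1 ≤ i) (hi' : i ≤ n - 1) (hj : 1 ≤ j) (hj' : j ≤ n - 1)
    (h : i + 1 < j ∨ j + 1 < i) : Commute (gY d n i) (gY d n j) := by
  simpa only [map_mul, gY, Commute, SemiconjBy] using mkY_rel (d := d) (.gg i j hi hi' hj hj' h)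

lemma gY_braid {i : ℕ} (hi : 1 ≤ i) (hi' : i ≤ n - 2) :
    gY d n i * gY d n (i + 1) * gY d n i = gY d n (i + 1) * gY d n i * gY d n (i + 1) := by
  simpa only [map_mul, gY] using mkY_rel (d := d) (.braid i hi hi')

lemma bY_commute_gY {i : ℕ} (hi : 2 ≤ i) (hi' : i ≤ n - 1) : Commute (bY d n) (gY d n i) := by
  simpa only [map_mul, gY, bY, Commute, SemiconjBy] using mkY_rel (d := d) (.bg i hi hi')

lemma bY_gY_bY_gY : bY d n * gY d n 1 * bY d n * gY d n 1 =
    gY d n 1 * bY d n * gY d n 1 * bY d n := by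
  simpa only [map_mul, gY, bY] using mkY_rel (d := d) (.bgbg (n := n))

lemma tY_of_not {j : ℕ} (h : ¬ (1 ≤ j ∧ j ≤ n)) : tY d n j = 1 := by
  simp [tY, Tt, h]

lemma tY_commute (i j : ℕ) : Commute (tY d n i) (tY d n j) := by
  by_cases hi : 1 ≤ i ∧ i ≤ n
  · by_cases hj : 1 ≤ j ∧ j ≤ n
    · simpa only [map_mul, tY, Commute, SemiconjBy]
        using mkY_rel (d := d) (.tt i j hi.1 hi.2 hj.1 hj.2)
    · rw [tY_of_not hj]; exact Commute.one_right _
  · rw [tY_of_not hi]; exact Commute.one_left _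

lemma tY_commute_bY (i : ℕ) : Commute (tY d n i) (bY d n) := by
  by_cases hi : 1 ≤ i ∧ i ≤ n
  · simpa only [map_mul, tY, bY, Commute, SemiconjBy] using mkY_rel (d := d) (.tb i hi.1 hi.2)
  · rw [tY_of_not hi]; exact Commute.one_left _

lemma tY_pow_card (i : ℕ) : tY d n i ^ d = 1 := by
  by_cases hi : 1 ≤ i ∧ i ≤ n
  · simpa only [map_pow, map_one, tY] using mkY_rel (d := d) (.td i hi.1 hi.2)
  · rw [tY_of_not hi, one_pow]

lemma tY_pow_mod (i m : ℕ) : tY d n i ^ (m % d) = tY d n i ^ m := by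
  conv_rhs => rw [← Nat.mod_add_div m d, pow_add, pow_mul, tY_pow_card, one_pow, mul_one]

lemma tY_mul_gY {i j : ℕ} (hi : 1 ≤ i) (hi' : i ≤ n - 1) (hj : 1 ≤ j) (hj' : j ≤ n) :
    tY d n j * gY d n i = gY d n i * tY d n (sAct i j) := by
  simpa only [map_mul, gY, tY] using mkY_rel (d := d) (.tg i j hi hi' hj hj')

lemma tY_commute_gY {i j : ℕ} (hi : 1 ≤ i) (hi' : i ≤ n - 1) (h : j ≠ i) (h' : j ≠ i + 1) :
    Commute (tY d n j) (gY d n i) := by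
  by_cases hj : 1 ≤ j ∧ j ≤ n
  · have := tY_mul_gY (d := d) hi hi' hj.1 hj.2
    rwa [sAct, if_neg h, if_neg h'] at this
  · rw [tY_of_not hj]; exact Commute.one_left _

lemma tY_pow_mul_gY {i : ℕ} (hi : 1 ≤ i) (hi' : i ≤ n - 1) (m : ℕ) :
    tY d n i ^ m * gY d n i = gY d n i * tY d n (i + 1) ^ m := by
  have h := tY_mul_gY (d := d) (n := n) hi hi' hi (by omega)
  rw [sAct, if_pos rfl] at h
  exact (SemiconjBy.pow_right (show SemiconjBy (gY d n i) _ _ from h.symm) m).eq.symm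

lemma tY_succ_pow_mul_gY {i : ℕ} (hi : 1 ≤ i) (hi' : i ≤ n - 1) (m : ℕ) :
    tY d n (i + 1) ^ m * gY d n i = gY d n i * tY d n i ^ m := by
  have h := tY_mul_gY (d := d) (n := n) (j := i + 1) hi hi' (by omega) (by omega)
  rw [sAct, if_neg (by omega), if_pos rfl] at h
  exact (SemiconjBy.pow_right (show SemiconjBy (gY d n i) _ _ from h.symm) m).eq.symm

lemma eY_eq (i : ℕ) : eY d n i =
    (d : Kf)⁻¹ • ∑ m ∈ Finset.range d, tY d n i ^ m * tY d n (i + 1) ^ (d - m) := by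
  simp only [eY, eF, map_smul, map_sum, map_mul, map_pow, tY]

lemma fY_eq : fY d n = (d : Kf)⁻¹ • ∑ m ∈ Finset.range d, tY d n 1 ^ m := by
  simp only [fY, fF, map_smul, map_sum, map_pow, tY]

lemma gY_mul_self {i : ℕ} (hi : 1 ≤ i) (hi' : i ≤ n - 1) :
    gY d n i * gY d n i = 1 + (uu - uu⁻¹) • (eY d n i * gY d n i) := by
  simpa only [map_mul, map_pow, map_add, map_one, map_smul, pow_two, gY, eY]
    using mkY_rel (d := d) (.gsq i hi hi')

lemma bY_mul_self : bY d n * bY d n = 1 + (vv - vv⁻¹) • (fY d n * bY d n) := by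
  simpa only [map_mul, map_pow, map_add, map_one, map_smul, pow_two, bY, fY]
    using mkY_rel (d := d) (.bsq (n := n))

lemma Commute.eY_right {r : YB d n} {i : ℕ} (h : Commute r (tY d n i))
    (h' : Commute r (tY d n (i + 1))) : Commute r (eY d n i) := by
  rw [eY_eq]
  exact (Commute.sum_right _ _ _ fun m _ ↦
    (h.pow_right m).mul_right (h'.pow_right (d - m))).smul_right _

lemma eY_commute_gY {i : ℕ} (hi : 1 ≤ i) (hi' : i ≤ n - 1) :
    Commute (eY d n i) (gY d n i) := by
  have key : ∑ m ∈ Finset.range d, tY d n (i + 1) ^ m * tY d n i ^ (d - m) =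
      ∑ m ∈ Finset.range d, tY d n i ^ m * tY d n (i + 1) ^ (d - m) := by
    have h := Finset.sum_flip (n := d) fun m ↦ tY d n i ^ m * tY d n (i + 1) ^ (d - m)
    rw [Finset.sum_range_succ, Finset.sum_range_succ] at h
    simp only [Nat.sub_self, Nat.sub_zero, pow_zero, tY_pow_card, mul_one,
      add_left_inj] at h
    rw [← h]
    refine Finset.sum_congr rfl fun m hm ↦ ?_
    rw [Nat.sub_sub_self (Finset.mem_range.1 hm).le]
    exact ((tY_commute _ _).pow_pow _ _).eq
  show _ * _ = _ * _
  rw [eY_eq, smul_mul_assoc, mul_smul_comm]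
  congr 1
  conv_rhs => rw [← key]
  rw [Finset.sum_mul, Finset.mul_sum]
  refine Finset.sum_congr rfl fun m _ ↦ ?_
  rw [mul_assoc, tY_succ_pow_mul_gY hi hi', ← mul_assoc, tY_pow_mul_gY hi hi', mul_assoc]

lemma gY_mul_gInv {i : ℕ} (hi : 1 ≤ i) (hi' : i ≤ n - 1) : gY d n i * gInv d n i = 1 := by
  rw [gInv, mul_sub, gY_mul_self hi hi', mul_smul_comm, (eY_commute_gY hi hi').eq,
    add_sub_cancel_right]

lemma gInv_mul_gY {i : ℕ} (hi : 1 ≤ i) (hi' : i ≤ n - 1) : gInv d n i * gY d n i = 1 := by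
  rw [gInv, sub_mul, gY_mul_self hi hi', smul_mul_assoc, add_sub_cancel_right]

lemma Commute.gInv_right {r : YB d n} {i : ℕ} (hi : 1 ≤ i) (hi' : i ≤ n - 1)
    (h : Commute r (gY d n i)) : Commute r (gInv d n i) :=
  commute_inv_right (gY_mul_gInv hi hi') (gInv_mul_gY hi hi') h

lemma bk_succ {k : ℕ} (hk : 1 ≤ k) :
    bk d n (k + 1) = gY d n k * bk d n k * gInv d n k := by
  obtain ⟨k, rfl⟩ := Nat.exists_eq_add_of_le' hk
  rfl

lemma bk_succ_mul_gY {k : ℕ} (hk : 1 ≤ k) (hk' : k ≤ n - 1) :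
    bk d n (k + 1) * gY d n k = gY d n k * bk d n k := by
  rw [bk_succ hk, mul_assoc, gInv_mul_gY hk hk', mul_one]

lemma tY_pow_mul_gInv {i : ℕ} (hi : 1 ≤ i) (hi' : i ≤ n - 1) (m : ℕ) :
    tY d n i ^ m * gInv d n i = gInv d n i * tY d n (i + 1) ^ m := by
  calc tY d n i ^ m * gInv d n i
      = gInv d n i * (gY d n i * tY d n i ^ m) * gInv d n i := by
        rw [← mul_assoc, gInv_mul_gY hi hi', one_mul]
    _ = gInv d n i * tY d n (i + 1) ^ m * (gY d n i * gInv d n i) := by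
        rw [← tY_succ_pow_mul_gY hi hi']; simp only [mul_assoc]
    _ = gInv d n i * tY d n (i + 1) ^ m := by rw [gY_mul_gInv hi hi', mul_one]

lemma tY_succ_pow_mul_gInv {i : ℕ} (hi : 1 ≤ i) (hi' : i ≤ n - 1) (m : ℕ) :
    tY d n (i + 1) ^ m * gInv d n i = gInv d n i * tY d n i ^ m := by
  calc tY d n (i + 1) ^ m * gInv d n i
      = gInv d n i * (gY d n i * tY d n (i + 1) ^ m) * gInv d n i := by
        rw [← mul_assoc, gInv_mul_gY hi hi', one_mul]
    _ = gInv d n i * tY d n i ^ m * (gY d n i * gInv d n i) := by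
        rw [← tY_pow_mul_gY hi hi']; simp only [mul_assoc]
    _ = gInv d n i * tY d n i ^ m := by rw [gY_mul_gInv hi hi', mul_one]

lemma tY_commute_bk (j : ℕ) {k : ℕ} (hk : 1 ≤ k) (hk' : k ≤ n) :
    Commute (tY d n j) (bk d n k) := by
  induction k, hk using Nat.le_induction generalizing j with
  | base => exact tY_commute_bY j
  | succ k hk ih =>
    have hk'' : k ≤ n - 1 := by omega
    rw [bk_succ hk]
    by_cases h : j = k
    · subst h
      have h₁ := tY_pow_mul_gY (d := d) hk hk'' 1
      have h₂ := tY_succ_pow_mul_gInv (d := d) hk hk'' 1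
      simp only [pow_one] at h₁ h₂
      show _ * _ = _ * _
      rw [← mul_assoc, ← mul_assoc, h₁, mul_assoc (gY d n j), (ih (j + 1) (by omega)).eq,
        ← mul_assoc, mul_assoc _ _ (gInv d n j), h₂, mul_assoc, mul_assoc, mul_assoc]
    · by_cases h' : j = k + 1
      · subst h'
        have h₁ := tY_succ_pow_mul_gY (d := d) hk hk'' 1
        have h₂ := tY_pow_mul_gInv (d := d) hk hk'' 1
        simp only [pow_one] at h₁ h₂
        show _ * _ = _ * _
        rw [← mul_assoc, ← mul_assoc, h₁, mul_assoc (gY d n k), (ih k (by omega)).eq,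
          ← mul_assoc, mul_assoc _ _ (gInv d n k), h₂, mul_assoc, mul_assoc, mul_assoc]
      · have hg := tY_commute_gY (d := d) hk hk'' h h'
        exact (hg.mul_right (ih j (by omega))).mul_right (hg.gInv_right hk hk'')

lemma bk_commute_gY_of_lt {k i : ℕ} (hk : 1 ≤ k) (hi : k < i) (hi' : i ≤ n - 1) :
    Commute (bk d n k) (gY d n i) := by
  induction k, hk using Nat.le_induction with
  | base => exact bY_commute_gY hi hi'
  | succ k hk ih =>
    have hg := gY_commute (d := d) (i := i) (j := k) (by omega) hi' hk (by omega) (.inr hi)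
    rw [bk_succ hk]
    exact ((hg.mul_right (ih (by omega)).symm).mul_right (hg.gInv_right hk (by omega))).symm

lemma bk_commute_gY_of_gt {k i : ℕ} (hi : 1 ≤ i) (hik : i + 2 ≤ k) (hk : k ≤ n) :
    Commute (bk d n k) (gY d n i) := by
  induction k, hik using Nat.le_induction with
  | base =>
    have h := gY_braid (d := d) (n := n) (i := i) hi (by omega)
    have e₁ := gInv_mul_gY (d := d) (n := n) (i := i) hi (by omega)
    have e₂ := gY_mul_gInv (d := d) (n := n) (i := i) hi (by omega)
    have e₃ := gInv_mul_gY (d := d) (n := n) (i := i + 1) (by omega) (by omega)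
    have e₄ := gY_mul_gInv (d := d) (n := n) (i := i + 1) (by omega) (by omega)
    have hb := bk_commute_gY_of_lt (d := d) (n := n) (k := i) (i := i + 1) hi (by omega) (by omega)
    rw [bk_succ (by omega), bk_succ hi]
    have h₁ : gInv d n i * (gInv d n (i + 1) * gY d n i) =
        gY d n (i + 1) * (gInv d n i * gInv d n (i + 1)) := by
      calc _ = gInv d n i * (gInv d n (i + 1) * gY d n i * gY d n (i + 1)) * gInv d n (i + 1) := by
            simp only [mul_assoc, e₄, mul_one]
        _ = gInv d n i * (gY d n i * gY d n (i + 1) * gInv d n i) * gInv d n (i + 1) := by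
            rw [inv_mul_mul_of_braid e₃ e₂ h.symm]
        _ = _ := by simp only [← mul_assoc, e₁, one_mul]
    show _ * _ = _ * _
    calc _ = gY d n (i + 1) * gY d n i * (bk d n i *
          (gInv d n i * (gInv d n (i + 1) * gY d n i))) := by simp only [mul_assoc]
      _ = gY d n (i + 1) * gY d n i * (bk d n i * gY d n (i + 1)) *
          (gInv d n i * gInv d n (i + 1)) := by rw [h₁]; simp only [mul_assoc]
      _ = (gY d n (i + 1) * gY d n i * gY d n (i + 1)) * bk d n i *
          (gInv d n i * gInv d n (i + 1)) := by rw [hb.eq]; simp only [mul_assoc]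
      _ = _ := by rw [← h]; simp only [mul_assoc]
  | succ k hik ih =>
    have hg := gY_commute (d := d) (n := n) (i := i) (j := k) hi (by omega) (by omega)
      (by omega) (.inl (by omega))
    rw [bk_succ (by omega)]
    exact ((hg.mul_right (ih (by omega)).symm).mul_right
      (hg.gInv_right (by omega) (by omega))).symm

/-- A subalgebra containing all the generators is everything. -/
lemma YB_eq_top (S : Subalgebra Kf (YB d n)) (hb : bY d n ∈ S)
    (hg : ∀ i, 1 ≤ i → i ≤ n - 1 → gY d n i ∈ S) (ht : ∀ j, 1 ≤ j → j ≤ n → tY d n j ∈ S) :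
    S = ⊤ := by
  have key : S.comap (mkY d n) = ⊤ := by
    rw [eq_top_iff, ← FreeAlgebra.adjoin_range_ι, Algebra.adjoin_le_iff]
    rintro _ ⟨x, rfl⟩
    show mkY d n _ ∈ S
    match x with
    | .b => exact hb
    | .g ⟨i, hi⟩ =>
      have := hg (i + 1) (by omega) (by omega)
      rwa [gY, Gg, dif_pos (by omega)] at this
    | .t ⟨i, hi⟩ =>
      have := ht (i + 1) (by omega) (by omega)
      rwa [tY, Tt, dif_pos (by omega)] at this
  rw [eq_top_iff]
  intro a _
  obtain ⟨a, rfl⟩ := RingQuot.mkAlgHom_surjective Kf (YBrel d n) a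
  exact (key ▸ Algebra.mem_top : a ∈ S.comap (mkY d n))

end Relations

/-! ### The natural inclusions -/

section Inclusion

variable {d N : ℕ} {inc : YB d N →ₐ[Kf] YB d (N + 1)}

lemma IsIncl.map_eY (h : IsIncl d N inc) {i : ℕ} (hi : 1 ≤ i) (hi' : i ≤ N - 1) :
    inc (eY d N i) = eY d (N + 1) i := by
  simp only [eY_eq, map_smul, map_sum, map_mul, map_pow, h.2.2 i hi (by omega),
    h.2.2 (i + 1) (by omega) (by omega)]

lemma IsIncl.map_gInv (h : IsIncl d N inc) {i : ℕ} (hi : 1 ≤ i) (hi' : i ≤ N - 1) :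
    inc (gInv d N i) = gInv d (N + 1) i := by
  simp only [gInv, map_sub, map_smul, h.map_eY hi hi', h.2.1 i hi hi']

lemma IsIncl.map_bk (h : IsIncl d N inc) {k : ℕ} (hk : 1 ≤ k) (hk' : k ≤ N) :
    inc (bk d N k) = bk d (N + 1) k := by
  induction k, hk using Nat.le_induction with
  | base => exact h.1
  | succ k hk ih =>
    rw [bk_succ hk, bk_succ hk, map_mul, map_mul, ih (by omega), h.2.1 k hk (by omega),
      h.map_gInv hk (by omega)]

lemma IsIncl.commute (h : IsIncl d N inc) {r : YB d (N + 1)} (hb : Commute r (bY d (N + 1)))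
    (hg : ∀ i, 1 ≤ i → i ≤ N - 1 → Commute r (gY d (N + 1) i))
    (ht : ∀ j, 1 ≤ j → j ≤ N → Commute r (tY d (N + 1) j)) (X : YB d N) :
    Commute r (inc X) := by
  have key : (Subalgebra.centralizer Kf {r}).comap inc = ⊤ := by
    refine YB_eq_top _ ?_ (fun i hi hi' ↦ ?_) fun j hj hj' ↦ ?_ <;>
      simp only [Subalgebra.mem_comap, Subalgebra.mem_centralizer_iff, Set.mem_singleton_iff,
        forall_eq]
    · rw [h.1]; exact hb.eq
    · rw [h.2.1 i hi hi']; exact (hg i hi hi').eq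
    · rw [h.2.2 j hj hj']; exact (ht j hj hj').eq
  have hX : X ∈ (Subalgebra.centralizer Kf {r}).comap inc := key ▸ Algebra.mem_top
  exact (Subalgebra.mem_centralizer_iff Kf).1 (Subalgebra.mem_comap _ _ _ |>.1 hX) r rfl

lemma IsIncl.tY_commute (h : IsIncl d N inc) (X : YB d N) :
    Commute (tY d (N + 1) (N + 1)) (inc X) :=
  h.commute (tY_commute_bY _)
    (fun i hi hi' ↦ tY_commute_gY hi (by omega) (by omega) (by omega))
    (fun j _ _ ↦ _root_.tY_commute _ _) X

lemma IsIncl.gY_commute {inc' : YB d (N + 1) →ₐ[Kf] YB d (N + 2)} (hN : 1 ≤ N)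
    (h : IsIncl d N inc) (h' : IsIncl d (N + 1) inc') (X : YB d N) :
    Commute (gY d (N + 2) (N + 1)) (inc' (inc X)) := by
  have key : (Subalgebra.centralizer Kf {gY d (N + 2) (N + 1)}).comap (inc'.comp inc) = ⊤ := by
    refine YB_eq_top _ ?_ (fun i hi hi' ↦ ?_) fun j hj hj' ↦ ?_ <;>
      simp only [Subalgebra.mem_comap, Subalgebra.mem_centralizer_iff, Set.mem_singleton_iff,
        forall_eq, AlgHom.comp_apply]
    · rw [h.1, h'.1]
      exact (bY_commute_gY (by omega) (by omega)).eq.symm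
    · rw [h.2.1 i hi hi', h'.2.1 i hi (by omega)]
      exact (_root_.gY_commute (by omega) (by omega) hi (by omega) (.inr (by omega))).eq
    · rw [h.2.2 j hj hj', h'.2.2 j hj (by omega)]
      exact (tY_commute_gY (by omega) (by omega) (by omega) (by omega)).eq.symm
  have hX : X ∈ (Subalgebra.centralizer Kf {gY d (N + 2) (N + 1)}).comap (inc'.comp inc) :=
    key ▸ Algebra.mem_top
  exact (Subalgebra.mem_centralizer_iff Kf).1 (Subalgebra.mem_comap _ _ _ |>.1 hX) _ rfl

end Inclusion

/-! ### Spanning sets -/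

section Spanning

variable {d n N : ℕ}

/-- The subalgebra of elements whose right multiplication preserves `V`. -/
def rightStab (V : Submodule Kf (YB d n)) : Subalgebra Kf (YB d n) where
  carrier := {r | ∀ X ∈ V, X * r ∈ V}
  mul_mem' := fun {r s} hr hs X hX ↦ by rw [← mul_assoc]; exact hs _ (hr X hX)
  add_mem' := fun {r s} hr hs X hX ↦ by rw [mul_add]; exact V.add_mem (hr X hX) (hs X hX)
  algebraMap_mem' := fun c X hX ↦ by
    rw [← Algebra.commutes, ← Algebra.smul_def]; exact V.smul_mem c hX

lemma mem_rightStab_span {G : Set (YB d n)} {r : YB d n} :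
    r ∈ rightStab (Submodule.span Kf G) ↔ ∀ X ∈ G, X * r ∈ Submodule.span Kf G := by
  refine ⟨fun h X hX ↦ h X (Submodule.subset_span hX), fun h X hX ↦ ?_⟩
  induction hX using Submodule.span_induction with
  | mem X hX => exact h X hX
  | zero => rw [zero_mul]; exact Submodule.zero_mem _
  | add X Y _ _ hX hY => rw [add_mul]; exact Submodule.add_mem _ hX hY
  | smul c X _ hX => rw [smul_mul_assoc]; exact Submodule.smul_mem _ c hX

lemma eq_top_of_rightStab {V : Submodule Kf (YB d n)} (h1 : 1 ∈ V) (h : rightStab V = ⊤) :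
    V = ⊤ := by
  rw [eq_top_iff]
  intro X _
  rw [← one_mul X]
  exact (h ▸ Algebra.mem_top : X ∈ rightStab V) 1 h1

lemma eY_mem {S : Subalgebra Kf (YB d n)} {i : ℕ} (h : tY d n i ∈ S)
    (h' : tY d n (i + 1) ∈ S) : eY d n i ∈ S := by
  rw [eY_eq]
  exact S.smul_mem (S.sum_mem fun m _ ↦ S.mul_mem (S.pow_mem h m) (S.pow_mem h' _)) _

/-- The elements `s t_n^m`, `s b_n t_n^m` and `s g_{n-1} a` with `s` and `a` in `S`. -/
def spanSet (S : Subalgebra Kf (YB d n)) : Set (YB d n) :=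
  {X | ∃ s ∈ S, (∃ m, X = s * tY d n n ^ m) ∨ (∃ m, X = s * (bk d n n * tY d n n ^ m)) ∨
    (2 ≤ n ∧ ∃ a ∈ S, X = s * (gY d n (n - 1) * a))}

section

variable {S : Subalgebra Kf (YB d n)}

lemma tY_pow_mem_span (m : ℕ) : tY d n n ^ m ∈ Submodule.span Kf (spanSet S) :=
  Submodule.subset_span ⟨1, S.one_mem, .inl ⟨m, (one_mul _).symm⟩⟩

lemma bk_mul_tY_pow_mem_span (m : ℕ) :
    bk d n n * tY d n n ^ m ∈ Submodule.span Kf (spanSet S) :=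
  Submodule.subset_span ⟨1, S.one_mem, .inr (.inl ⟨m, (one_mul _).symm⟩)⟩

lemma gY_mul_mem_span (hn : 2 ≤ n) {a : YB d n} (ha : a ∈ S) :
    gY d n (n - 1) * a ∈ Submodule.span Kf (spanSet S) :=
  Submodule.subset_span ⟨1, S.one_mem, .inr (.inr ⟨hn, a, ha, (one_mul _).symm⟩)⟩

lemma mul_mem_span {s X : YB d n} (hs : s ∈ S) (hX : X ∈ Submodule.span Kf (spanSet S)) :
    s * X ∈ Submodule.span Kf (spanSet S) := by
  induction hX using Submodule.span_induction with
  | mem X hX =>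
    obtain ⟨s', hs', ⟨m, rfl⟩ | ⟨m, rfl⟩ | ⟨hn, a, ha, rfl⟩⟩ := hX <;> rw [← mul_assoc]
    · exact Submodule.subset_span ⟨_, S.mul_mem hs hs', .inl ⟨m, rfl⟩⟩
    · exact Submodule.subset_span ⟨_, S.mul_mem hs hs', .inr (.inl ⟨m, rfl⟩)⟩
    · exact Submodule.subset_span ⟨_, S.mul_mem hs hs', .inr (.inr ⟨hn, a, ha, rfl⟩)⟩
  | zero => rw [mul_zero]; exact Submodule.zero_mem _
  | add X Y _ _ hX hY => rw [mul_add]; exact Submodule.add_mem _ hX hY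
  | smul c X _ hX => rw [mul_smul_comm]; exact Submodule.smul_mem _ c hX

lemma mem_rightStab_spanSet {r : YB d n}
    (h₁ : ∀ m, tY d n n ^ m * r ∈ Submodule.span Kf (spanSet S))
    (h₂ : ∀ m, bk d n n * tY d n n ^ m * r ∈ Submodule.span Kf (spanSet S))
    (h₃ : 2 ≤ n → ∀ a ∈ S, gY d n (n - 1) * a * r ∈ Submodule.span Kf (spanSet S)) :
    r ∈ rightStab (Submodule.span Kf (spanSet S)) := by
  refine mem_rightStab_span.2 ?_
  rintro _ ⟨s, hs, ⟨m, rfl⟩ | ⟨m, rfl⟩ | ⟨hn, a, ha, rfl⟩⟩ <;> rw [mul_assoc] <;>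
    refine mul_mem_span hs ?_
  exacts [h₁ m, h₂ m, h₃ hn a ha]

lemma tY_mem_rightStab (h : ∀ a ∈ S, Commute (tY d n n) a)
    (hS : 2 ≤ n → tY d n (n - 1) ∈ S) :
    tY d n n ∈ rightStab (Submodule.span Kf (spanSet S)) := by
  refine mem_rightStab_spanSet (fun m ↦ ?_) (fun m ↦ ?_) fun hn a ha ↦ ?_
  · rw [← pow_succ]; exact tY_pow_mem_span _
  · rw [mul_assoc, ← pow_succ]; exact bk_mul_tY_pow_mem_span _
  · obtain ⟨k, rfl⟩ := Nat.exists_eq_add_of_le' hn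
    have := tY_pow_mul_gY (d := d) (n := k + 2) (i := k + 1) (by omega) (by omega) 1
    simp only [pow_one] at this
    show gY d (k + 2) (k + 1) * a * tY d (k + 2) (k + 2) ∈ _
    rw [mul_assoc, ← (h a ha).eq, ← mul_assoc, ← this, mul_assoc]
    exact mul_mem_span (hS hn) (gY_mul_mem_span hn ha)

end

lemma span_spanSet_one : Submodule.span Kf (spanSet (⊥ : Subalgebra Kf (YB d 1))) = ⊤ := by
  have ht : tY d 1 1 ∈ rightStab (Submodule.span Kf (spanSet (⊥ : Subalgebra Kf (YB d 1)))) := by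
    refine tY_mem_rightStab (fun a ha ↦ ?_) (by omega)
    obtain ⟨c, rfl⟩ := Algebra.mem_bot.1 ha
    exact (Algebra.commutes c _).symm
  have hb (m : ℕ) : tY d 1 1 ^ m * bY d 1 = bY d 1 * tY d 1 1 ^ m :=
    ((tY_commute_bY 1).pow_left m).eq
  refine eq_top_of_rightStab (by simpa using tY_pow_mem_span (d := d) (n := 1) 0)
    (YB_eq_top _ ?_ (by omega) fun j hj hj' ↦ by rwa [le_antisymm hj' hj])
  refine mem_rightStab_spanSet (fun m ↦ ?_) (fun m ↦ ?_) (by omega)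
  · rw [hb]; exact bk_mul_tY_pow_mem_span m
  · rw [mul_assoc, hb, ← mul_assoc]
    refine (Subalgebra.pow_mem _ ht m) _ ?_
    change bY d 1 * bY d 1 ∈ _
    rw [bY_mul_self, fY_eq, smul_mul_assoc, Finset.sum_mul]
    refine Submodule.add_mem _ (by simpa using tY_pow_mem_span (d := d) (n := 1) 0) <|
      Submodule.smul_mem _ _ <| Submodule.smul_mem _ _ <| Submodule.sum_mem _ fun l _ ↦ ?_
    rw [hb]; exact bk_mul_tY_pow_mem_span l

variable {inc : YB d N →ₐ[Kf] YB d (N + 1)} {S : Subalgebra Kf (YB d N)}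

lemma gY_mem_rightStab (hN : 1 ≤ N) (hinc : IsIncl d N inc)
    (hS : ∀ s ∈ S, Commute (gY d (N + 1) N) (inc s))
    (hV : Submodule.span Kf (spanSet S) = ⊤)
    (ht : tY d (N + 1) N ∈ rightStab (Submodule.span Kf (spanSet inc.range)))
    (ht' : tY d (N + 1) (N + 1) ∈ rightStab (Submodule.span Kf (spanSet inc.range))) :
    gY d (N + 1) N ∈ rightStab (Submodule.span Kf (spanSet inc.range)) := by
  have hg {a : YB d N} := gY_mul_mem_span (S := inc.range) (n := N + 1) (by omega)
    (inc.mem_range_self a)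
  simp only [Nat.add_sub_cancel] at hg
  have he := eY_mem ht ht'
  have h₁ (m : ℕ) : tY d (N + 1) (N + 1) ^ m * gY d (N + 1) N ∈
      Submodule.span Kf (spanSet inc.range) := by
    rw [tY_succ_pow_mul_gY hN (by omega), ← hinc.2.2 N hN le_rfl, ← map_pow]
    exact hg
  have h₂ : bk d (N + 1) (N + 1) * gY d (N + 1) N ∈ Submodule.span Kf (spanSet inc.range) := by
    rw [bk_succ_mul_gY hN (by omega), ← hinc.map_bk hN le_rfl]
    exact hg
  have hsq {X : YB d (N + 1)} (hX : X ∈ Submodule.span Kf (spanSet inc.range))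
      (hX' : X * gY d (N + 1) N ∈ Submodule.span Kf (spanSet inc.range)) :
      X * (gY d (N + 1) N * gY d (N + 1) N) ∈ Submodule.span Kf (spanSet inc.range) := by
    rw [gY_mul_self hN (by omega), (eY_commute_gY hN (by omega)).eq, mul_add, mul_one,
      mul_smul_comm, ← mul_assoc]
    exact Submodule.add_mem _ hX (Submodule.smul_mem _ _ (he _ hX'))
  refine mem_rightStab_spanSet h₁ (fun m ↦ ?_) ?_
  · rw [mul_assoc, tY_succ_pow_mul_gY hN (by omega), ← mul_assoc]
    exact (Subalgebra.pow_mem _ ht m) _ h₂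
  rintro - _ ⟨a, rfl⟩
  show gY d (N + 1) N * inc a * gY d (N + 1) N ∈ _
  have ha : a ∈ Submodule.span Kf (spanSet S) := hV ▸ Submodule.mem_top
  induction ha using Submodule.span_induction with
  | mem a ha =>
    obtain ⟨s, hs, h⟩ := ha
    suffices ∀ c, gY d (N + 1) N * inc c * gY d (N + 1) N ∈
        Submodule.span Kf (spanSet inc.range) →
        gY d (N + 1) N * inc (s * c) * gY d (N + 1) N ∈
          Submodule.span Kf (spanSet inc.range) by
      obtain ⟨m, rfl⟩ | ⟨m, rfl⟩ | ⟨h2, a, ha, rfl⟩ := h <;> refine this _ ?_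
      · rw [map_pow, hinc.2.2 N hN le_rfl, ← tY_succ_pow_mul_gY hN (by omega), mul_assoc]
        exact hsq (tY_pow_mem_span m) (h₁ m)
      · rw [map_mul, map_pow, hinc.2.2 N hN le_rfl, hinc.map_bk hN le_rfl, mul_assoc, mul_assoc,
          tY_pow_mul_gY hN (by omega), ← mul_assoc (bk _ _ _), ← mul_assoc, ← mul_assoc,
          ← bk_succ_mul_gY hN (by omega), mul_assoc (bk _ _ _)]
        refine (Subalgebra.pow_mem _ ht' m) _ (hsq ?_ h₂)
        simpa using bk_mul_tY_pow_mem_span (d := d) (n := N + 1) (S := inc.range) 0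
      · obtain ⟨k, rfl⟩ := Nat.exists_eq_add_of_le' h2
        have hbr := gY_braid (d := d) (n := k + 3) (i := k + 1) (by omega) (by omega)
        simp only [Nat.add_succ_sub_one] at hbr ⊢
        have : gY d (k + 3) (k + 2) * inc (gY d (k + 2) (k + 1) * a) * gY d (k + 3) (k + 2) =
            inc (gY d (k + 2) (k + 1)) *
              (gY d (k + 3) (k + 2) * inc (gY d (k + 2) (k + 1) * a)) := by
          rw [map_mul, hinc.2.1 (k + 1) (by omega) (by omega), mul_assoc, mul_assoc,
            ← (hS a ha).eq, ← mul_assoc, ← mul_assoc, ← hbr]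
          simp only [mul_assoc]
        rw [this]
        exact mul_mem_span (inc.mem_range_self _) hg
    intro c hc
    rw [map_mul, ← mul_assoc, (hS s hs).eq, mul_assoc, mul_assoc, ← mul_assoc (gY _ _ _)]
    exact mul_mem_span (inc.mem_range_self s) hc
  | zero => rw [map_zero, mul_zero, zero_mul]; exact Submodule.zero_mem _
  | add X Y _ _ hX hY => rw [map_add, mul_add, add_mul]; exact Submodule.add_mem _ hX hY
  | smul c X _ hX =>
    rw [map_smul, mul_smul_comm, smul_mul_assoc]; exact Submodule.smul_mem _ c hX

lemma span_spanSet_succ (hN : 1 ≤ N) (hinc : IsIncl d N inc)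
    (hS : ∀ s ∈ S, Commute (gY d (N + 1) N) (inc s))
    (hV : Submodule.span Kf (spanSet S) = ⊤) :
    Submodule.span Kf (spanSet inc.range) = ⊤ := by
  have hg {a : YB d N} := gY_mul_mem_span (S := inc.range) (n := N + 1) (by omega)
    (inc.mem_range_self a)
  simp only [Nat.add_sub_cancel] at hg
  have of_commute {a : YB d N} (ha : Commute (bk d (N + 1) (N + 1)) (inc a)) :
      inc a ∈ rightStab (Submodule.span Kf (spanSet inc.range)) := by
    have hta (m : ℕ) := ((hinc.tY_commute a).pow_left m).eq
    refine mem_rightStab_spanSet (fun m ↦ ?_) (fun m ↦ ?_) fun _ ↦ ?_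
    · rw [hta]; exact mul_mem_span (inc.mem_range_self a) (tY_pow_mem_span m)
    · rw [mul_assoc, hta, ← mul_assoc, ha.eq, mul_assoc]
      exact mul_mem_span (inc.mem_range_self a) (bk_mul_tY_pow_mem_span m)
    · rintro _ ⟨a', rfl⟩
      show gY d (N + 1) N * inc a' * inc a ∈ _
      rw [mul_assoc, ← map_mul]
      exact hg
  have ht (j : ℕ) (hj : 1 ≤ j) (hj' : j ≤ N) :
      tY d (N + 1) j ∈ rightStab (Submodule.span Kf (spanSet inc.range)) := by
    rw [← hinc.2.2 j hj hj']
    refine of_commute ?_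
    rw [hinc.2.2 j hj hj']
    exact (tY_commute_bk j (by omega) le_rfl).symm
  have ht' : tY d (N + 1) (N + 1) ∈ rightStab (Submodule.span Kf (spanSet inc.range)) := by
    refine tY_mem_rightStab ?_ fun _ ↦ ⟨_, hinc.2.2 N hN le_rfl⟩
    rintro _ ⟨a, rfl⟩
    exact hinc.tY_commute a
  have hgN := gY_mem_rightStab hN hinc hS hV (ht N hN le_rfl) ht'
  have he := eY_mem (ht N hN le_rfl) ht'
  have hgi : gInv d (N + 1) N ∈ rightStab (Submodule.span Kf (spanSet inc.range)) :=
    Subalgebra.sub_mem _ hgN (Subalgebra.smul_mem _ he _)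
  have hbb : bk d (N + 1) (N + 1) * bY d (N + 1) ∈ Submodule.span Kf (spanSet inc.range) := by
    rw [bk_succ hN]
    obtain rfl | hN' := eq_or_lt_of_le hN
    · show gY d 2 1 * bY d 2 * gInv d 2 1 * bY d 2 ∈ _
      have heb : Commute (bY d 2) (eY d 2 1) :=
        Commute.eY_right (tY_commute_bY _).symm (tY_commute_bY _).symm
      rw [gInv, mul_sub, sub_mul, ← bY_gY_bY_gY, mul_smul_comm, smul_mul_assoc,
        mul_assoc _ (eY d 2 1), ← heb.eq]
      rw [← hinc.1]
      refine Submodule.sub_mem _ (hgN _ ?_) (Submodule.smul_mem _ _ ?_)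
      · rw [mul_assoc]
        exact mul_mem_span (inc.mem_range_self _) hg
      · rw [← mul_assoc, mul_assoc (gY d 2 1), ← map_mul]
        exact he _ hg
    · rw [mul_assoc, ← ((bY_commute_gY (d := d) hN' (by omega)).gInv_right hN (by omega)).eq,
        ← mul_assoc, mul_assoc (gY _ _ _), ← hinc.1, ← hinc.map_bk hN le_rfl, ← map_mul]
      exact hgi _ hg
  refine eq_top_of_rightStab (by simpa using tY_pow_mem_span (d := d) (n := N + 1) 0)
    (YB_eq_top _ ?_ (fun i hi hi' ↦ ?_) fun j hj hj' ↦ ?_)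
  · refine mem_rightStab_spanSet (fun m ↦ ?_) (fun m ↦ ?_) fun _ ↦ ?_
    · rw [((tY_commute_bY _).pow_left m).eq, ← hinc.1]
      exact mul_mem_span (inc.mem_range_self _) (tY_pow_mem_span m)
    · rw [mul_assoc, ((tY_commute_bY _).pow_left m).eq, ← mul_assoc]
      exact (Subalgebra.pow_mem _ ht' m) _ hbb
    · rintro _ ⟨a, rfl⟩
      show gY d (N + 1) N * inc a * bY d (N + 1) ∈ _
      rw [mul_assoc, ← hinc.1, ← map_mul]
      exact hg
  · obtain rfl | hlt := eq_or_ne i N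
    · exact hgN
    rw [← hinc.2.1 i hi (by omega)]
    refine of_commute ?_
    rw [hinc.2.1 i hi (by omega)]
    exact bk_commute_gY_of_gt hi (by omega) le_rfl
  · obtain rfl | hlt := eq_or_ne j (N + 1)
    · exact ht'
    · exact ht j hj (by omega)

end Spanning

/-! ### The inductive basis as a spanning set -/

section Basis

variable {d n N : ℕ}

lemma gRange_self (j : ℕ) : gRange d n j j = 1 := by simp [gRange]

lemma gRange_succ {j k : ℕ} (h : j ≤ k) :
    gRange d n j (k + 1) = gY d n k * gRange d n j k := by
  rw [gRange, gRange, Nat.sub_add_comm h, List.range'_concat]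
  simp [Nat.add_sub_cancel' h]

lemma mPlus_eq {j k : ℕ} (m : ℕ) : mPlus d n k j m = gRange d n j k * tY d n j ^ m := by
  obtain rfl | h := eq_or_ne j k
  · rw [gRange_self, one_mul]; exact if_pos rfl
  · exact if_neg h

lemma mMinus_eq {j k : ℕ} (hk : 1 ≤ k) (hk' : k ≤ n) (m : ℕ) :
    mMinus d n k j m = gRange d n j k * (bk d n j * tY d n j ^ m) := by
  obtain rfl | h := eq_or_ne j k
  · rw [gRange_self, one_mul, ← ((tY_commute_bk j hk hk').pow_left m).eq]; exact if_pos rfl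
  · exact if_neg h

lemma exists_eq_of_mem_Mset {k : ℕ} (hk : 1 ≤ k) (hk' : k ≤ n) {μ : YB d n}
    (hμ : μ ∈ Mset d n k) : ∃ j m, 1 ≤ j ∧ j ≤ k ∧ m ≤ d - 1 ∧
      (μ = gRange d n j k * tY d n j ^ m ∨
        μ = gRange d n j k * (bk d n j * tY d n j ^ m)) := by
  induction k, hk using Nat.le_induction generalizing μ with
  | base =>
    obtain ⟨m, hm, rfl | rfl⟩ := hμ
    · exact ⟨1, m, le_rfl, le_rfl, hm, .inl (by rw [gRange_self, one_mul])⟩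
    · exact ⟨1, m, le_rfl, le_rfl, hm,
        .inr (by rw [gRange_self, one_mul, ((tY_commute_bY 1).pow_left m).eq]; rfl)⟩
  | succ k hk ih =>
    obtain ⟨k, rfl⟩ := Nat.exists_eq_add_of_le' hk
    obtain ⟨m, hm, rfl | rfl⟩ | ⟨y, hy, rfl⟩ := hμ
    · exact ⟨k + 2, m, by omega, le_rfl, hm, .inl (by rw [gRange_self, one_mul])⟩
    · exact ⟨k + 2, m, by omega, le_rfl, hm, .inr (by
        rw [gRange_self, one_mul, ((tY_commute_bk _ (by omega) hk').pow_left m).eq])⟩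
    · obtain ⟨j, m, hj, hjk, hm, h⟩ := ih (by omega) hy
      refine ⟨j, m, hj, by omega, hm, ?_⟩
      rw [gRange_succ hjk]
      simp only [mul_assoc]
      exact h.imp (congrArg _) (congrArg _)

lemma tY_pow_mem_Mset (hd : 1 ≤ d) {k : ℕ} (hk : 1 ≤ k) (m : ℕ) :
    tY d n k ^ m ∈ Mset d n k := by
  have hm : m % d ≤ d - 1 := Nat.le_sub_one_of_lt (Nat.mod_lt m hd)
  rw [← tY_pow_mod]
  obtain rfl | ⟨k, rfl⟩ := hk.eq_or_lt.imp_right Nat.exists_eq_add_of_le'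
  · exact ⟨_, hm, .inl rfl⟩
  · exact .inl ⟨_, hm, .inl rfl⟩

lemma bk_mul_tY_pow_mem_Mset (hd : 1 ≤ d) {k : ℕ} (hk : 1 ≤ k) (hk' : k ≤ n) (m : ℕ) :
    bk d n k * tY d n k ^ m ∈ Mset d n k := by
  have hm : m % d ≤ d - 1 := Nat.le_sub_one_of_lt (Nat.mod_lt m hd)
  rw [← tY_pow_mod, ← ((tY_commute_bk k hk hk').pow_left _).eq]
  obtain rfl | ⟨k, rfl⟩ := hk.eq_or_lt.imp_right Nat.exists_eq_add_of_le'
  · exact ⟨_, hm, .inr rfl⟩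
  · exact .inl ⟨_, hm, .inr rfl⟩

lemma gY_mul_mem_Mset {k : ℕ} (hk : 1 ≤ k) {μ : YB d n} (hμ : μ ∈ Mset d n k) :
    gY d n k * μ ∈ Mset d n (k + 1) := by
  obtain ⟨k, rfl⟩ := Nat.exists_eq_add_of_le' hk
  exact .inr ⟨μ, hμ, rfl⟩

/-- The elements `s 𝔪` with `s` in `S` and `𝔪` in `M_{d,n}`. -/
def prodSet (S : Subalgebra Kf (YB d n)) : Set (YB d n) :=
  {X | ∃ s ∈ S, ∃ μ ∈ Mset d n n, X = s * μ}

lemma span_prodSet_one (hd : 1 ≤ d) :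
    Submodule.span Kf (prodSet (⊥ : Subalgebra Kf (YB d 1))) = ⊤ := by
  rw [eq_top_iff, ← span_spanSet_one, Submodule.span_le]
  rintro _ ⟨s, hs, ⟨m, rfl⟩ | ⟨m, rfl⟩ | ⟨h, _⟩⟩
  · exact Submodule.subset_span ⟨s, hs, _, tY_pow_mem_Mset hd le_rfl m, rfl⟩
  · exact Submodule.subset_span ⟨s, hs, _, bk_mul_tY_pow_mem_Mset hd le_rfl le_rfl m, rfl⟩
  · omega

lemma span_Cset_one (hd : 1 ≤ d) : Submodule.span Kf (Cset d 1) = ⊤ := by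
  rw [eq_top_iff, ← span_prodSet_one hd, Submodule.span_le]
  rintro _ ⟨s, hs, μ, hμ, rfl⟩
  obtain ⟨c, rfl⟩ := Algebra.mem_bot.1 hs
  rw [← Algebra.smul_def]
  refine Submodule.smul_mem _ c (Submodule.subset_span ⟨fun _ ↦ μ, fun i ↦ ?_, by simp⟩)
  rw [Fin.val_eq_zero i]
  exact hμ

variable {inc : YB d N →ₐ[Kf] YB d (N + 1)} {S : Subalgebra Kf (YB d N)}

lemma IsIncl.map_gRange (h : IsIncl d N inc) {j k : ℕ} (hj : 1 ≤ j) (hjk : j ≤ k) (hk : k ≤ N) :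
    inc (gRange d N j k) = gRange d (N + 1) j k := by
  induction k, hjk using Nat.le_induction with
  | base => simp only [gRange_self, map_one]
  | succ k hjk ih =>
    rw [gRange_succ hjk, gRange_succ hjk, map_mul, ih (by omega),
      h.2.1 k (by omega) (by omega)]

lemma IsIncl.map_mem_Mset (h : IsIncl d N inc) {k : ℕ} (hk : 1 ≤ k) (hk' : k ≤ N) {μ : YB d N}
    (hμ : μ ∈ Mset d N k) : inc μ ∈ Mset d (N + 1) k := by
  induction k, hk using Nat.le_induction generalizing μ with
  | base =>
    obtain ⟨m, hm, rfl | rfl⟩ := hμ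
    · exact ⟨m, hm, .inl (by rw [map_pow, h.2.2 1 le_rfl hk'])⟩
    · exact ⟨m, hm, .inr (by rw [map_mul, map_pow, h.2.2 1 le_rfl hk', h.1])⟩
  | succ k hk ih =>
    obtain ⟨k, rfl⟩ := Nat.exists_eq_add_of_le' hk
    obtain ⟨m, hm, rfl | rfl⟩ | ⟨y, hy, rfl⟩ := hμ
    · exact .inl ⟨m, hm, .inl (by rw [map_pow, h.2.2 _ (by omega) hk'])⟩
    · exact .inl ⟨m, hm, .inr (by
        rw [map_mul, map_pow, h.2.2 _ (by omega) hk', h.map_bk (by omega) hk'])⟩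
    · exact .inr ⟨inc y, ih (by omega) hy, by
        rw [map_mul, h.2.1 _ (by omega) (by omega)]⟩

lemma IsIncl.mul_mem_Cset (h : IsIncl d N inc) {w : YB d N} (hw : w ∈ Cset d N)
    {μ : YB d (N + 1)} (hμ : μ ∈ Mset d (N + 1) (N + 1)) : inc w * μ ∈ Cset d (N + 1) := by
  obtain ⟨f, hf, rfl⟩ := hw
  refine ⟨Fin.snoc (fun i ↦ inc (f i)) μ, fun i ↦ ?_, ?_⟩
  · induction i using Fin.lastCases with
    | last => simpa using hμ
    | cast i => simpa using h.map_mem_Mset (by omega) (by omega) (hf i)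
  · rw [List.ofFn_succ_last, List.prod_append, map_list_prod, List.map_ofFn]
    simp [Function.comp_def]

lemma span_prodSet_succ (hd : 1 ≤ d) (hN : 1 ≤ N) (hinc : IsIncl d N inc)
    (hS : ∀ s ∈ S, Commute (gY d (N + 1) N) (inc s))
    (hV : Submodule.span Kf (spanSet S) = ⊤) (hQ : Submodule.span Kf (prodSet S) = ⊤) :
    Submodule.span Kf (prodSet inc.range) = ⊤ := by
  rw [eq_top_iff, ← span_spanSet_succ hN hinc hS hV, Submodule.span_le]
  rintro _ ⟨s, hs, ⟨m, rfl⟩ | ⟨m, rfl⟩ | ⟨-, _, ⟨a, rfl⟩, rfl⟩⟩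
  · exact Submodule.subset_span ⟨s, hs, _, tY_pow_mem_Mset hd (by omega) m, rfl⟩
  · exact Submodule.subset_span ⟨s, hs, _, bk_mul_tY_pow_mem_Mset hd (by omega) le_rfl m, rfl⟩
  show s * (gY d (N + 1) N * inc a) ∈ Submodule.span Kf (prodSet inc.range)
  have ha : a ∈ Submodule.span Kf (prodSet S) := hQ ▸ Submodule.mem_top
  induction ha using Submodule.span_induction with
  | mem a ha =>
    obtain ⟨s', hs', μ, hμ, rfl⟩ := ha
    rw [map_mul, ← mul_assoc (gY _ _ _), (hS s' hs').eq, mul_assoc, ← mul_assoc s]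
    exact Submodule.subset_span ⟨_, Subalgebra.mul_mem _ hs (inc.mem_range_self s'), _,
      gY_mul_mem_Mset hN (hinc.map_mem_Mset hN le_rfl hμ), rfl⟩
  | zero => rw [map_zero, mul_zero, mul_zero]; exact Submodule.zero_mem _
  | add X Y _ _ hX hY => rw [map_add, mul_add, mul_add]; exact Submodule.add_mem _ hX hY
  | smul c X _ hX =>
    rw [map_smul, mul_smul_comm, mul_smul_comm]; exact Submodule.smul_mem _ c hX

lemma span_Cset_succ (hinc : IsIncl d N inc) (hC : Submodule.span Kf (Cset d N) = ⊤)
    (hQ : Submodule.span Kf (prodSet inc.range) = ⊤) :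
    Submodule.span Kf (Cset d (N + 1)) = ⊤ := by
  rw [eq_top_iff, ← hQ, Submodule.span_le]
  rintro _ ⟨_, ⟨w, rfl⟩, μ, hμ, rfl⟩
  show inc w * μ ∈ Submodule.span Kf (Cset d (N + 1))
  have hw : w ∈ Submodule.span Kf (Cset d N) := hC ▸ Submodule.mem_top
  induction hw using Submodule.span_induction with
  | mem w hw => exact Submodule.subset_span (hinc.mul_mem_Cset hw hμ)
  | zero => rw [map_zero, zero_mul]; exact Submodule.zero_mem _
  | add X Y _ _ hX hY => rw [map_add, add_mul]; exact Submodule.add_mem _ hX hY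
  | smul c X _ hX => rw [map_smul, smul_mul_assoc]; exact Submodule.smul_mem _ c hX

/-- The image of `Y_{d,n-1}^B` in `Y_{d,n}^B`, which for `n ≤ 1` consists of the scalars. -/
def lowerAlg (inc : (k : ℕ) → (YB d k →ₐ[Kf] YB d (k + 1))) :
    (N : ℕ) → Subalgebra Kf (YB d N)
  | 0 => ⊥
  | 1 => ⊥
  | N + 2 => (inc (N + 1)).range

lemma gY_commute_lowerAlg {inc : (k : ℕ) → (YB d k →ₐ[Kf] YB d (k + 1))}
    (hinc : ∀ k, 1 ≤ k → IsIncl d k (inc k)) (hN : 1 ≤ N) :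
    ∀ s ∈ lowerAlg inc N, Commute (gY d (N + 1) N) (inc N s) := by
  obtain rfl | ⟨N, rfl⟩ := hN.eq_or_lt.imp_right Nat.exists_eq_add_of_le'
  · rintro s hs
    obtain ⟨c, rfl⟩ := Algebra.mem_bot.1 hs
    rw [AlgHom.commutes]
    exact (Algebra.commutes c _).symm
  · rintro _ ⟨s, rfl⟩
    exact (hinc (N + 1) (by omega)).gY_commute (by omega) (hinc (N + 2) (by omega)) s

lemma span_eq_top (hd : 1 ≤ d) {inc : (k : ℕ) → (YB d k →ₐ[Kf] YB d (k + 1))}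
    (hinc : ∀ k, 1 ≤ k → IsIncl d k (inc k)) (hN : 1 ≤ N) :
    Submodule.span Kf (spanSet (lowerAlg inc N)) = ⊤ ∧
      Submodule.span Kf (prodSet (lowerAlg inc N)) = ⊤ ∧ Submodule.span Kf (Cset d N) = ⊤ := by
  induction N, hN using Nat.le_induction with
  | base => exact ⟨span_spanSet_one, span_prodSet_one hd, span_Cset_one hd⟩
  | succ N hN ih =>
    obtain ⟨hV, hQ, hC⟩ := ih
    have hS := gY_commute_lowerAlg hinc hN
    have hr : lowerAlg inc (N + 1) = (inc N).range := by
      obtain ⟨N, rfl⟩ := Nat.exists_eq_add_of_le' hN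
      rfl
    have hQ' := span_prodSet_succ hd hN (hinc N hN) hS hV hQ
    rw [hr]
    exact ⟨span_spanSet_succ hN (hinc N hN) hS hV, hQ', span_Cset_succ (hinc N hN) hC hQ'⟩

end Basis

/-! ### Properties of the relative traces -/

section Trace

variable {d N : ℕ} {x y : ZMod d → Kf} {inc : YB d N →ₐ[Kf] YB d (N + 1)}
  {tr : YB d (N + 1) →ₗ[Kf] YB d N} {S : Subalgebra Kf (YB d N)}

lemma map_inc_mul_of_span {C : Set (YB d N)} (hC : Submodule.span Kf C = ⊤) {r : YB d (N + 1)}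
    {r' : YB d N} (h : ∀ w ∈ C, tr (inc w * r) = w * r') (w : YB d N) :
    tr (inc w * r) = w * r' := by
  have hw : w ∈ Submodule.span Kf C := hC ▸ Submodule.mem_top
  induction hw using Submodule.span_induction with
  | mem w hw => exact h w hw
  | zero => rw [map_zero, zero_mul, zero_mul, map_zero]
  | add X Y _ _ hX hY => rw [map_add, add_mul, add_mul, map_add, hX, hY]
  | smul c X _ hX => rw [map_smul, smul_mul_assoc, smul_mul_assoc, map_smul, hX]

namespace IsRelTrace

lemma apply_tY_pow (hd : 1 ≤ d) (htr : IsRelTrace d x y N inc tr)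
    (hC : Submodule.span Kf (Cset d N) = ⊤) (w : YB d N) (m : ℕ) :
    tr (inc w * tY d (N + 1) (N + 1) ^ m) = x (m : ZMod d) • w := by
  rw [← tY_pow_mod, ← ZMod.natCast_mod m d, ← mul_one w, ← mul_smul_comm, mul_one w]
  refine map_inc_mul_of_span hC (fun w hw ↦ ?_) w
  rw [(htr w hw _ (Nat.le_sub_one_of_lt (Nat.mod_lt m hd))).1, mul_smul_comm, mul_one]

lemma apply_bk_mul_tY_pow (hd : 1 ≤ d) (htr : IsRelTrace d x y N inc tr)
    (hC : Submodule.span Kf (Cset d N) = ⊤) (w : YB d N) (m : ℕ) :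
    tr (inc w * (bk d (N + 1) (N + 1) * tY d (N + 1) (N + 1) ^ m)) = y (m : ZMod d) • w := by
  rw [← tY_pow_mod, ← ZMod.natCast_mod m d, ← mul_one w, ← mul_smul_comm, mul_one w]
  refine map_inc_mul_of_span hC (fun w hw ↦ ?_) w
  rw [(htr w hw _ (Nat.le_sub_one_of_lt (Nat.mod_lt m hd))).2.1, mul_smul_comm, mul_one]

lemma apply_gY_mul_Mset (htr : IsRelTrace d x y N inc tr) (hinc : IsIncl d N inc) (hN : 1 ≤ N)
    (hC : Submodule.span Kf (Cset d N) = ⊤) (w : YB d N) {μ : YB d N} (hμ : μ ∈ Mset d N N) :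
    tr (inc w * (gY d (N + 1) N * inc μ)) = zz • (w * μ) := by
  rw [← mul_smul_comm]
  refine map_inc_mul_of_span hC (fun w hw ↦ ?_) w
  rw [mul_smul_comm]
  obtain ⟨j, m, hj, hjN, hm, rfl | rfl⟩ := exists_eq_of_mem_Mset hN le_rfl hμ
  · have h := ((htr w hw m hm).2.2 j hj hjN).1
    rw [mPlus_eq, mPlus_eq, gRange_succ hjN] at h
    rw [← h, map_mul inc, map_pow, hinc.map_gRange hj hjN le_rfl, hinc.2.2 j hj hjN]
    simp only [mul_assoc]
  · have h := ((htr w hw m hm).2.2 j hj hjN).2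
    rw [mMinus_eq (by omega) le_rfl, mMinus_eq hN le_rfl, gRange_succ hjN] at h
    rw [← h, map_mul inc, map_mul inc, map_pow, hinc.map_gRange hj hjN le_rfl, hinc.2.2 j hj hjN,
      hinc.map_bk hj hjN]
    simp only [mul_assoc]

lemma apply_mul_gY_mul (htr : IsRelTrace d x y N inc tr) (hinc : IsIncl d N inc) (hN : 1 ≤ N)
    (hC : Submodule.span Kf (Cset d N) = ⊤) (hQ : Submodule.span Kf (prodSet S) = ⊤)
    (hS : ∀ s ∈ S, Commute (gY d (N + 1) N) (inc s)) (a b : YB d N) :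
    tr (inc a * (gY d (N + 1) N * inc b)) = zz • (a * b) := by
  have hb : b ∈ Submodule.span Kf (prodSet S) := hQ ▸ Submodule.mem_top
  induction hb using Submodule.span_induction with
  | mem b hb =>
    obtain ⟨s, hs, μ, hμ, rfl⟩ := hb
    rw [map_mul inc, ← mul_assoc (gY _ _ _), (hS s hs).eq, mul_assoc, ← mul_assoc, ← map_mul,
      htr.apply_gY_mul_Mset hinc hN hC _ hμ, mul_assoc]
  | zero => simp only [map_zero, mul_zero, smul_zero]
  | add X Y _ _ hX hY => simp only [map_add, mul_add, smul_add, hX, hY]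
  | smul c X _ hX => rw [map_smul, mul_smul_comm, mul_smul_comm, map_smul, hX, mul_smul_comm,
      smul_comm]

lemma apply_mul_gY_mul_eY (hd : 1 ≤ d) (hinc : IsIncl d N inc) (hN : 1 ≤ N)
    (hg : ∀ a b, tr (inc a * (gY d (N + 1) N * inc b)) = zz • (a * b)) (a : YB d N) {c : YB d N}
    (hc : Commute (tY d N N) c) (m : ℕ) :
    tr (inc a * (gY d (N + 1) N * inc c * eY d (N + 1) N * tY d (N + 1) (N + 1) ^ m)) =
      zz • (a * (c * tY d N N ^ m)) := by
  have hterm (l : ℕ) (hl : l ∈ Finset.range d) :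
      tr (inc a * (gY d (N + 1) N * inc c * (tY d (N + 1) N ^ l *
        tY d (N + 1) (N + 1) ^ (d - l)) * tY d (N + 1) (N + 1) ^ m)) =
      zz • (a * (c * tY d N N ^ m)) := by
    have hl' : l ≤ d := (Finset.mem_range.1 hl).le
    have e : gY d (N + 1) N * inc c * (tY d (N + 1) N ^ l *
        tY d (N + 1) (N + 1) ^ (d - l)) * tY d (N + 1) (N + 1) ^ m =
        inc (tY d N N ^ (d - l + m)) * (gY d (N + 1) N * inc (c * tY d N N ^ l)) := by
      rw [map_pow, hinc.2.2 N hN le_rfl, ← mul_assoc (_ ^ _), tY_pow_mul_gY hN (by omega),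
        map_mul inc,
        map_pow, hinc.2.2 N hN le_rfl]
      have h₁ := ((hinc.tY_commute c).pow_left (d - l + m)).eq
      have h₂ := ((tY_commute (d := d) (n := N + 1) N (N + 1)).pow_pow l (d - l + m)).eq
      simp only [mul_assoc]
      rw [← pow_add, h₂, ← mul_assoc (inc c), ← h₁, mul_assoc]
    rw [e, ← mul_assoc, ← map_mul, hg, mul_assoc, ← mul_assoc _ c, (hc.pow_left _).eq, mul_assoc c,
      ← pow_add, show d - l + m + l = d + m by omega, pow_add, tY_pow_card, one_mul]
  have : CharZero Kf := charZero_of_injective_algebraMap (R := ℂ) (algebraMap ℂ Kf).injective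
  have hd' : (d : Kf) ≠ 0 := Nat.cast_ne_zero.2 (by omega)
  rw [eY_eq, mul_smul_comm, smul_mul_assoc, mul_smul_comm, map_smul, Finset.mul_sum,
    Finset.sum_mul, Finset.mul_sum, map_sum, Finset.sum_congr rfl hterm, Finset.sum_const,
    Finset.card_range, ← Nat.cast_smul_eq_nsmul Kf, smul_smul, inv_mul_cancel₀ hd', one_smul]

end IsRelTrace

lemma gInv_mul_bk_mul_gY (hN : 1 ≤ N) (hinc : IsIncl d N inc) :
    gInv d (N + 1) N * bk d (N + 1) N * gY d (N + 1) N = bk d (N + 1) (N + 1) +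
      (uu - uu⁻¹) • (gY d (N + 1) N * inc (bk d N N) * eY d (N + 1) N -
        inc (bk d N N) * (gY d (N + 1) N * eY d (N + 1) N)) := by
  have hbe : Commute (bk d (N + 1) N) (eY d (N + 1) N) :=
    Commute.eY_right (tY_commute_bk _ hN (by omega)).symm (tY_commute_bk _ hN (by omega)).symm
  have heg := eY_commute_gY (d := d) (n := N + 1) hN (by omega)
  rw [gInv, sub_mul, sub_mul, ← bk_succ_mul_gY hN (by omega), mul_assoc (bk _ _ _),
    gY_mul_self hN (by omega), hinc.map_bk hN le_rfl, smul_mul_assoc, smul_mul_assoc, ← hbe.eq,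
    mul_assoc _ (eY _ _ _), heg.eq, mul_add, mul_one, mul_smul_comm, ← mul_assoc (bk _ _ (N + 1)),
    bk_succ_mul_gY hN (by omega), smul_sub, add_sub_assoc]

/-- Conjugation by `g_N` turns the relative trace into any linear map `T` which satisfies the
defining rules of the trace one level below. -/
lemma IsRelTrace.apply_conj (hd : 1 ≤ d) (htr : IsRelTrace d x y N inc tr)
    (hinc : IsIncl d N inc) (hN : 1 ≤ N) (hC : Submodule.span Kf (Cset d N) = ⊤)
    (hQ : Submodule.span Kf (prodSet S) = ⊤) (hV : Submodule.span Kf (spanSet S) = ⊤)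
    (hS : ∀ s ∈ S, Commute (gY d (N + 1) N) (inc s)) (T : YB d N →ₗ[Kf] YB d N)
    (hTt : ∀ s ∈ S, ∀ m : ℕ, T (s * tY d N N ^ m) = x (m : ZMod d) • s)
    (hTb : ∀ s ∈ S, ∀ m : ℕ, T (s * (bk d N N * tY d N N ^ m)) = y (m : ZMod d) • s)
    (hTg : 2 ≤ N → ∀ s ∈ S, ∀ a ∈ S, T (s * (gY d N (N - 1) * a)) = zz • (s * a)) (X : YB d N) :
    tr (gY d (N + 1) N * inc X * gInv d (N + 1) N) = T X ∧
      tr (gInv d (N + 1) N * inc X * gY d (N + 1) N) = T X := by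
  have hg := htr.apply_mul_gY_mul hinc hN hC hQ hS
  have hgi := gY_mul_gInv (d := d) (n := N + 1) hN (by omega)
  have hig := gInv_mul_gY (d := d) (n := N + 1) hN (by omega)
  have hSi (s) (hs : s ∈ S) : Commute (gInv d (N + 1) N) (inc s) :=
    ((hS s hs).symm.gInv_right hN (by omega)).symm
  have hX : X ∈ Submodule.span Kf (spanSet S) := hV ▸ Submodule.mem_top
  induction hX using Submodule.span_induction with
  | mem X hX =>
    obtain ⟨s, hs, h⟩ := hX
    suffices ∀ c, tr (inc s * (gY d (N + 1) N * inc c * gInv d (N + 1) N)) = T (s * c) ∧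
        tr (inc s * (gInv d (N + 1) N * inc c * gY d (N + 1) N)) = T (s * c) →
        tr (gY d (N + 1) N * inc (s * c) * gInv d (N + 1) N) = T (s * c) ∧
        tr (gInv d (N + 1) N * inc (s * c) * gY d (N + 1) N) = T (s * c) by
      obtain ⟨m, rfl⟩ | ⟨m, rfl⟩ | ⟨h2, a, ha, rfl⟩ := h <;> refine this _ ?_
      · rw [map_pow, hinc.2.2 N hN le_rfl, ← tY_succ_pow_mul_gY hN (by omega), mul_assoc, hgi,
          mul_one, mul_assoc _ _ (gY _ _ _), tY_pow_mul_gY hN (by omega), ← mul_assoc _ (gY _ _ _),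
          hig, one_mul, hTt s hs, htr.apply_tY_pow hd hC]
        exact ⟨rfl, rfl⟩
      · have e₁ : gY d (N + 1) N * inc (bk d N N * tY d N N ^ m) * gInv d (N + 1) N =
            bk d (N + 1) (N + 1) * tY d (N + 1) (N + 1) ^ m := by
          rw [map_mul inc, map_pow, hinc.2.2 N hN le_rfl, hinc.map_bk hN le_rfl, bk_succ hN]
          simp only [mul_assoc]
          rw [tY_pow_mul_gInv hN (by omega)]
        have e₂ : gInv d (N + 1) N * inc (bk d N N * tY d N N ^ m) * gY d (N + 1) N =
            gInv d (N + 1) N * bk d (N + 1) N * gY d (N + 1) N * tY d (N + 1) (N + 1) ^ m := by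
          rw [map_mul inc, map_pow, hinc.2.2 N hN le_rfl, hinc.map_bk hN le_rfl]
          simp only [mul_assoc]
          rw [tY_pow_mul_gY hN (by omega)]
        have e₃ := apply_mul_gY_mul_eY hd hinc hN hg s (tY_commute_bk N hN le_rfl) m
        have e₄ := apply_mul_gY_mul_eY hd hinc hN hg (s * bk d N N) (Commute.one_right _) m
        rw [map_one, mul_one, one_mul, map_mul inc, mul_assoc s, mul_assoc (inc s)] at e₄
        rw [e₁, e₂, hTb s hs, htr.apply_bk_mul_tY_pow hd hC, gInv_mul_bk_mul_gY hN hinc, add_mul,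
          smul_mul_assoc, sub_mul, mul_add, mul_smul_comm, mul_sub, map_add, map_smul, map_sub,
          htr.apply_bk_mul_tY_pow hd hC, e₃, mul_assoc (inc (bk _ _ _)), e₄, sub_self, smul_zero,
          add_zero]
        exact ⟨rfl, rfl⟩
      · rw [hTg h2 s hs a ha]
        obtain ⟨k, rfl⟩ := Nat.exists_eq_add_of_le' h2
        have hbr := gY_braid (d := d) (n := k + 3) (i := k + 1) (by omega) (by omega)
        have hgi' := gY_mul_gInv (d := d) (n := k + 3) (i := k + 1) (by omega) (by omega)
        have hig' := gInv_mul_gY (d := d) (n := k + 3) (i := k + 1) (by omega) (by omega)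
        have hgi'' := gY_mul_gInv (d := d) (n := k + 2) (i := k + 1) (by omega) (by omega)
        have hig'' := gInv_mul_gY (d := d) (n := k + 2) (i := k + 1) (by omega) (by omega)
        simp only [Nat.add_succ_sub_one]
        have e₁ : inc s * (gY d (k + 3) (k + 2) * inc (gY d (k + 2) (k + 1) * a) *
            gInv d (k + 3) (k + 2)) = inc (s * gInv d (k + 2) (k + 1)) *
              (gY d (k + 3) (k + 2) * inc (gY d (k + 2) (k + 1) * a)) := by
          rw [map_mul inc, map_mul inc, hinc.2.1 (k + 1) (by omega) (by omega),
            hinc.map_gInv (by omega) (by omega), mul_assoc (gY _ _ _), mul_assoc (gY _ _ _),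
            ← (hSi a ha).eq, mul_assoc (inc s), ← mul_assoc (gY _ _ (k + 1)),
            ← mul_assoc (gY _ _ _), ← mul_assoc (gY _ _ _),
            mul_mul_inv_of_braid hgi hig' hbr.symm]
          simp only [mul_assoc]
        have e₂ : inc s * (gInv d (k + 3) (k + 2) * inc (gY d (k + 2) (k + 1) * a) *
            gY d (k + 3) (k + 2)) = inc (s * gY d (k + 2) (k + 1)) *
              (gY d (k + 3) (k + 2) * inc (gInv d (k + 2) (k + 1) * a)) := by
          rw [map_mul inc, map_mul inc, map_mul inc, hinc.2.1 (k + 1) (by omega) (by omega),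
            hinc.map_gInv (by omega) (by omega), mul_assoc (gInv _ _ _), mul_assoc (gY _ _ _),
            ← (hS a ha).eq, ← mul_assoc (gY _ _ (k + 1)), ← mul_assoc (gInv _ _ _),
            ← mul_assoc (gInv _ _ _), inv_mul_mul_of_braid hig hgi' hbr.symm]
          simp only [mul_assoc]
        rw [e₁, e₂, hg, hg, mul_assoc, mul_assoc, ← mul_assoc (gInv _ _ _), hig'', one_mul,
          ← mul_assoc (gY _ _ _), hgi'', one_mul]
        exact ⟨rfl, rfl⟩
    intro c hc
    rw [map_mul inc, ← mul_assoc, (hS s hs).eq, ← mul_assoc, (hSi s hs).eq]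
    simpa only [mul_assoc] using hc
  | zero => simp only [map_zero, mul_zero, zero_mul, and_self]
  | add X Y _ _ hX hY =>
    simp only [map_add, mul_add, add_mul, hX.1, hY.1, hX.2, hY.2, and_self]
  | smul c X _ hX =>
    simp only [map_smul, mul_smul_comm, smul_mul_assoc, hX.1, hX.2, and_self]

end Trace

/-- here `tr k` is the relative trace `tr_{k+2} : Y_{d,k+2}^B → Y_{d,k+1}^B`
and `tr1` is `tr_1 : Y_{d,1}^B → L`: for every `n ≥ 2` and `X ∈ Y_{d,n-1}^B`,
`tr_n(g_{n-1} X g_{n-1}⁻¹) = tr_{n-1}(X) = tr_n(g_{n-1}⁻¹ X g_{n-1})`, where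
`tr_{n-1}(X)` is regarded as an element of `Y_{d,n-1}^B` via the natural inclusion
(for `n = 2`, via the structure map `L → Y_{d,1}^B`). -/
theorem stmt15 (d : ℕ) (hd : 1 ≤ d)
    (x y : ZMod d → Kf) (hx0 : x 0 = 1) (hx : ∀ i, x i ≠ 0) (hy : ∀ i, y i ≠ 0)
    (inc : (k : ℕ) → (YB d k →ₐ[Kf] YB d (k + 1))) (hinc : ∀ k, 1 ≤ k → IsIncl d k (inc k))
    (tr1 : YB d 1 →ₗ[Kf] Kf) (htr1 : IsTr1 d x y tr1)
    (tr : (k : ℕ) → (YB d (k + 2) →ₗ[Kf] YB d (k + 1)))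
    (htr : ∀ k, IsRelTrace d x y (k + 1) (inc (k + 1)) (tr k)) :
    (∀ X : YB d 1,
      tr 0 (gY d 2 1 * inc 1 X * gInv d 2 1) = algebraMap Kf (YB d 1) (tr1 X) ∧
      tr 0 (gInv d 2 1 * inc 1 X * gY d 2 1) = algebraMap Kf (YB d 1) (tr1 X)) ∧
    (∀ (k : ℕ) (X : YB d (k + 2)),
      tr (k + 1) (gY d (k + 3) (k + 2) * inc (k + 2) X * gInv d (k + 3) (k + 2)) =
        inc (k + 1) (tr k X) ∧
      tr (k + 1) (gInv d (k + 3) (k + 2) * inc (k + 2) X * gY d (k + 3) (k + 2)) =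
        inc (k + 1) (tr k X)) := by
  refine ⟨fun X ↦ ?_, fun k X ↦ ?_⟩
  · obtain ⟨hV, hQ, hC⟩ := span_eq_top hd hinc le_rfl
    refine (htr 0).apply_conj hd (hinc 1 le_rfl) le_rfl hC hQ hV
      (gY_commute_lowerAlg hinc le_rfl) (Algebra.linearMap Kf (YB d 1) ∘ₗ tr1) ?_ ?_ (by omega) X
    all_goals
      intro s hs m
      obtain ⟨c, rfl⟩ := Algebra.mem_bot.1 hs
      have h := htr1 (m % d) (Nat.le_sub_one_of_lt (Nat.mod_lt m hd))
      rw [tY_pow_mod, ZMod.natCast_mod] at h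
      rw [← Algebra.smul_def, map_smul, LinearMap.comp_apply, Algebra.linearMap_apply]
    · rw [h.1, Algebra.smul_def, Algebra.smul_def, Algebra.commutes]
    · rw [bk, h.2, Algebra.smul_def, Algebra.smul_def, Algebra.commutes]
  · obtain ⟨hV, hQ, hC⟩ := span_eq_top (N := k + 2) hd hinc (by omega)
    obtain ⟨-, hQ', hC'⟩ := span_eq_top (N := k + 1) hd hinc (by omega)
    refine (htr (k + 1)).apply_conj hd (hinc (k + 2) (by omega)) (by omega) hC hQ hV
      (gY_commute_lowerAlg hinc (by omega)) ((inc (k + 1)).toLinearMap ∘ₗ tr k) ?_ ?_ ?_ X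
    · rintro _ ⟨s, rfl⟩ m
      exact (congrArg (inc (k + 1)) ((htr k).apply_tY_pow hd hC' s m)).trans
        (map_smul (inc (k + 1)) _ _)
    · rintro _ ⟨s, rfl⟩ m
      exact (congrArg (inc (k + 1)) ((htr k).apply_bk_mul_tY_pow hd hC' s m)).trans
        (map_smul (inc (k + 1)) _ _)
    · rintro - _ ⟨s, rfl⟩ _ ⟨a, rfl⟩
      refine (congrArg (inc (k + 1)) ((htr k).apply_mul_gY_mul (hinc (k + 1) (by omega))
        (by omega) hC' hQ' (gY_commute_lowerAlg hinc (by omega)) s a)).trans ?_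
      rw [map_smul, map_mul]
      rfl
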